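/- arXiv:2510.10310 — 2 statements merged into one kernel-verified Lean document; each statement's English description precedes it below -/
import Mathlib

section
/- Let f(x) = x^d + c with c a nonzero integer and d ≥ 2. Suppose f^N(α) = ε·y^p for some integers α, y, some prime p dividing d, and some ε = ±1, where N = 4 if d = 2 and N = 3 if d ≥ 3. Then α is a preperiodic point of f and ε·y^p is a periodic point of f. -/
/-- Distinct integers whose absolute values are `n`-th powers are far apart. -/
lemma pow_gap {n : ℕ} (hn : 2 ≤ n) {A B a b : ℤ} (ha : 0 ≤ a) (hb : 0 ≤ b)
    (hA : |A| = a ^ n) (hB : |B| = b ^ n) (hAB : A ≠ B) :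
    (2 * b - 1) * b ^ (n - 2) ≤ |A - B| := by
  obtain ⟨m, rfl⟩ := Nat.exists_eq_add_of_le' hn
  rw [Nat.add_sub_cancel]
  have hbm : 0 ≤ b ^ m := pow_nonneg hb m
  have hsplit : b ^ (m + 2) = b ^ 2 * b ^ m := by ring
  rcases lt_trichotomy a b with hlt | rfl | hlt
  · have h1 : a ^ m ≤ b ^ m := pow_le_pow_left₀ ha hlt.le m
    have h2 : a ^ (m + 2) ≤ (b - 1) ^ 2 * b ^ m := by
      calc a ^ (m + 2) = a ^ 2 * a ^ m := by ring
        _ ≤ (b - 1) ^ 2 * b ^ m := by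
          refine mul_le_mul (pow_le_pow_left₀ ha (by lia) 2) h1 (pow_nonneg ha m) (sq_nonneg _)
    have h3 := abs_sub_abs_le_abs_sub B A
    rw [abs_sub_comm B A] at h3
    nlinarith
  · have hBA : A = -B := (abs_eq_abs.mp (hA.trans hB.symm)).resolve_left hAB
    have h1 : |A - B| = 2 * a ^ (m + 2) := by
      rw [← hB, hBA, show -B - B = (-2) * B by ring, abs_mul]
      norm_num
    rw [h1, hsplit]
    nlinarith [mul_nonneg (sq_nonneg a) hbm, mul_nonneg (sq_nonneg (a - 1)) hbm]
  · have h1 : b ^ m ≤ a ^ m := pow_le_pow_left₀ hb hlt.le m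
    have h2 : (b + 1) ^ 2 * b ^ m ≤ a ^ (m + 2) := by
      calc (b + 1) ^ 2 * b ^ m ≤ a ^ 2 * a ^ m :=
            mul_le_mul (pow_le_pow_left₀ (by lia) (by lia) 2) h1 hbm (sq_nonneg _)
        _ = a ^ (m + 2) := by ring
    have h3 := abs_sub_abs_le_abs_sub A B
    nlinarith

lemma abs_unit_mul_pow {ε : ℤ} (hε : ε = 1 ∨ ε = -1) (y : ℤ) (p : ℕ) :
    |ε * y ^ p| = |y| ^ p := by
  rcases hε with rfl | rfl <;> simp [abs_pow]

lemma abs_pow_ne {n : ℕ} (hn : 2 ≤ n) (y : ℤ) : |y| ^ n ≠ 2 ∧ |y| ^ n ≠ 3 := by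
  rcases le_or_gt 2 |y| with hy | hy
  · have h1 : |y| ^ 2 ≤ |y| ^ n := pow_le_pow_right₀ (by lia) hn
    constructor <;> nlinarith
  · have h1 : |y| ^ n ≤ 1 := pow_le_one₀ (abs_nonneg y) (by lia)
    constructor <;> lia

lemma periodic_of_quadratic {c x₀ x₁ x₂ x₃ : ℤ} (h₁ : x₀ ^ 2 + c = x₁) (h₂ : x₁ ^ 2 + c = x₂)
    (h₃ : x₂ ^ 2 + c = x₃) (hc : 2 * |x₃| - 1 ≤ |c|) : x₃ = x₁ := by
  have hle := le_abs_self x₃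
  have hneg : c ≤ 0 := by
    by_contra! hpos
    rw [abs_of_pos hpos] at hc
    nlinarith [sq_nonneg x₂, sq_nonneg x₁, sq_nonneg x₀]
  rw [abs_of_nonpos hneg] at hc
  have hkey : 2 * x₂ ^ 2 + 3 * x₂ ≤ 3 * |x₁| ^ 2 + 1 := by
    rw [sq_abs]; lia
  have hdiff : |x₁| ^ 2 - |x₀| ^ 2 = x₂ - x₁ := by
    rw [sq_abs, sq_abs]; lia
  have hx₁ := abs_choice x₁
  have hu := abs_nonneg x₁
  have hv := abs_nonneg x₀
  generalize |x₁| = u at *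
  generalize |x₀| = v at *
  have hx : x₁ ≤ u ∧ -u ≤ x₁ := by lia
  have hcycle : x₂ = x₁ ∨ x₁ + x₂ = -1 := by
    rcases lt_trichotomy u v with huv | huv | huv
    · rcases eq_or_lt_of_le (Int.add_one_le_iff.mpr huv) with hv1 | hv1
      · subst hv1
        rcases hx₁ with h | h
        · right; nlinarith
        · have : x₂ = -3 * u - 1 := by nlinarith
          subst this
          have : u = 0 := by nlinarith
          lia
      · have hsq : (u + 2) ^ 2 ≤ v ^ 2 := pow_le_pow_left₀ (by lia) (by lia) 2
        have hx₂ : x₂ ≤ -3 * u - 4 := by linarith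
        clear * - hkey hx₂ hu
        nlinarith
    · left; subst huv; lia
    · rcases eq_or_lt_of_le (Int.add_one_le_iff.mpr huv) with hv1 | hv1
      · subst hv1
        rcases hx₁ with h | h
        · have : x₂ = 3 * (v + 1) - 1 := by nlinarith
          subst this
          nlinarith
        · right; nlinarith
      · have hsq : v ^ 2 ≤ (u - 2) ^ 2 := pow_le_pow_left₀ hv (by lia) 2
        have hx₂ : 3 * u - 4 ≤ x₂ := by linarith
        have hu2 : 2 ≤ u := by lia
        clear * - hkey hx₂ hu2
        nlinarith
  rcases hcycle with h | h
  · subst h; lia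
  · obtain rfl : x₂ = -1 - x₁ := by lia
    nlinarith

lemma abs_le_one_of_higher_degree {c x₀ x₁ x₂ : ℤ} {d : ℕ} (hd : 3 ≤ d)
    (h₁ : x₀ ^ d + c = x₁) (h₂ : x₁ ^ d + c = x₂) (hc : |x₂| ^ 2 ≤ |c|)
    (hne : x₀ ^ d ≠ x₁ ^ d) : |x₁| ≤ 1 := by
  by_contra! hu
  have hgap := pow_gap (by lia : 2 ≤ d) (abs_nonneg x₀) (abs_nonneg x₁)
    (abs_pow x₀ d) (abs_pow x₁ d) hne
  rw [show x₀ ^ d - x₁ ^ d = x₁ - x₂ by lia] at hgap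
  have hw := abs_sub x₁ x₂
  have hcu : |c| ≤ |x₂| + |x₁| ^ d := by
    rw [← abs_pow, show c = x₂ - x₁ ^ d by lia]; exact abs_sub _ _
  have hs : |x₁| ≤ |x₁| ^ (d - 2) := le_self_pow₀ (by lia) (by lia)
  have hpow : |x₁| ^ d = |x₁| ^ (d - 2) * |x₁| ^ 2 := by
    rw [← pow_add]; congr 1; lia
  rw [hpow] at hcu
  generalize |x₁| ^ (d - 2) = s at *
  generalize |x₁| = u at *
  generalize |x₂| = w at *
  have hlow : u * (3 * s - 2) ≤ 2 * w := by nlinarith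
  have hbig : 8 ≤ u * (3 * s - 2) := by nlinarith
  have hq : (u * (3 * s - 2)) * (u * (3 * s - 2) - 2) ≤ 4 * (s * u ^ 2) := by nlinarith
  have hq' : (3 * s - 2) * (u * (3 * s - 2) - 2) ≤ 4 * (s * u) := by
    refine le_of_mul_le_mul_left ?_ (by lia : 0 < u)
    nlinarith
  nlinarith [mul_nonneg (by lia : 0 ≤ u - 2) (by lia : 0 ≤ s - 2),
    mul_nonneg (mul_nonneg (by lia : 0 ≤ u - 2) (by lia : 0 ≤ s - 2)) (by lia : 0 ≤ s - 2),
    sq_nonneg (s - 2)]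

lemma periodic_of_higher_degree {c x₀ x₁ x₂ x₃ : ℤ} {d : ℕ} (hd : 3 ≤ d) (hc0 : c ≠ 0)
    (h₁ : x₀ ^ d + c = x₁) (h₂ : x₁ ^ d + c = x₂) (h₃ : x₂ ^ d + c = x₃)
    (hc : |x₂| ^ 2 ≤ |c|) (hx₃ : |x₃| ≠ 2) : x₃ = x₁ := by
  by_cases heq : x₀ ^ d = x₁ ^ d
  · obtain rfl : x₁ = x₂ := by lia
    lia
  have hu := abs_le.mp (abs_le_one_of_higher_degree hd h₁ h₂ hc heq)
  have hx₀ := abs_pow_ne (by lia : 2 ≤ d) x₀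
  rw [← abs_pow] at hx₀
  rw [sq_abs] at hc
  have hsq : ∀ t : ℤ, t ^ 2 ≤ |c| → |t| ≤ |c| := fun t ht => by
    rcases abs_cases t with ⟨h, _⟩ | ⟨h, _⟩ <;> nlinarith
  have hcases : x₁ = -1 ∨ x₁ = 0 ∨ x₁ = 1 := by lia
  rcases hcases with rfl | rfl | rfl
  · rcases Nat.even_or_odd d with hev | hodd
    · rw [hev.neg_one_pow] at h₂
      subst h₂
      have hcc : c = -1 ∨ c = -2 := by
        rcases abs_cases c with ⟨h, _⟩ | ⟨h, _⟩
        · rw [h] at hc; nlinarith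
        · rw [h] at hc
          have : -3 < c := by nlinarith
          lia
      rcases hcc with rfl | rfl
      · rw [show (1 + -1 : ℤ) = 0 by norm_num, zero_pow (by lia)] at h₃; lia
      · rw [show (1 + -2 : ℤ) = -1 by norm_num, hev.neg_one_pow] at h₃; lia
    · rw [hodd.neg_one_pow] at h₂
      subst h₂
      have hcc : c = 1 ∨ c = 2 := by
        rcases abs_cases c with ⟨h, _⟩ | ⟨h, _⟩
        · rw [h] at hc
          have : c < 3 := by nlinarith
          lia
        · rw [h] at hc; nlinarith
      rcases hcc with rfl | rfl
      · rw [show x₀ ^ d = -2 by lia] at hx₀; simp at hx₀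
      · rw [show x₀ ^ d = -3 by lia] at hx₀; simp at hx₀
  · rw [zero_pow (by lia), zero_add] at h₂
    subst h₂
    have hcc : c = 1 ∨ c = -1 := by
      rcases abs_cases c with ⟨h, _⟩ | ⟨h, _⟩
      · rw [h] at hc
        have : c < 2 := by nlinarith
        lia
      · rw [h] at hc
        have : -2 < c := by nlinarith
        lia
    rcases hcc with rfl | rfl
    · rw [one_pow] at h₃; subst h₃; simp at hx₃
    · rcases Nat.even_or_odd d with hev | hodd
      · rw [hev.neg_one_pow] at h₃; lia
      · rw [hodd.neg_one_pow] at h₃; subst h₃; simp at hx₃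
  · rw [one_pow] at h₂
    subst h₂
    have hcc : c = -1 ∨ c = -2 := by
      rcases abs_cases c with ⟨h, _⟩ | ⟨h, _⟩
      · rw [h] at hc; nlinarith
      · rw [h] at hc
        have : -3 < c := by nlinarith
        lia
    rcases hcc with rfl | rfl
    · rw [show x₀ ^ d = 2 by lia] at hx₀; simp at hx₀
    · rw [show x₀ ^ d = 3 by lia] at hx₀; simp at hx₀

/-- If a translate by `c` of the `(p * e)`-th power of `x` is a `p`-th power up to sign, then `c`
is large compared with `x`. -/
lemma pow_gap_translate {c x y ε : ℤ} {p e : ℕ} (hp : 2 ≤ p) (hc : c ≠ 0)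
    (hε : ε = 1 ∨ ε = -1) (h : x ^ (p * e) + c = ε * y ^ p) :
    (2 * |x| ^ e - 1) * (|x| ^ e) ^ (p - 2) ≤ |c| := by
  have hgap := pow_gap hp (abs_nonneg y) (pow_nonneg (abs_nonneg x) e)
    (abs_unit_mul_pow hε y p) (B := x ^ (p * e))
    (by rw [abs_pow, mul_comm, pow_mul]) (by lia)
  rwa [show ε * y ^ p - x ^ (p * e) = c by lia] at hgap

lemma sq_abs_le_of_translate {c x y ε : ℤ} {p e : ℕ} (hp : 2 ≤ p) (hd : 3 ≤ p * e) (hc : c ≠ 0)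
    (hε : ε = 1 ∨ ε = -1) (h : x ^ (p * e) + c = ε * y ^ p) : |x| ^ 2 ≤ |c| := by
  rcases (abs_nonneg x).eq_or_lt with hx | hx
  · rw [← hx]; simp
  have hz : 1 ≤ |x| ^ e := one_le_pow₀ hx
  have hexp : 2 ≤ e * (p - 1) := by
    obtain ⟨q, rfl⟩ := Nat.exists_eq_add_of_le' hp
    rcases e with _ | _ | e
    · lia
    · lia
    · rw [show q + 2 - 1 = q + 1 by lia]; nlinarith
  calc |x| ^ 2 ≤ |x| ^ (e * (p - 1)) := pow_le_pow_right₀ hx hexp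
    _ = |x| ^ e * (|x| ^ e) ^ (p - 2) := by
      rw [pow_mul, ← pow_succ']; congr 1; lia
    _ ≤ (2 * |x| ^ e - 1) * (|x| ^ e) ^ (p - 2) :=
      mul_le_mul_of_nonneg_right (by lia) (pow_nonneg (by lia) _)
    _ ≤ |c| := pow_gap_translate hp hc hε h

theorem stmt6 (c : ℤ) (d : ℕ) (hc : c ≠ 0) (hd : 2 ≤ d)
    (α y ε : ℤ) (p : ℕ) (hp : p.Prime) (hpd : p ∣ d) (hε : ε = 1 ∨ ε = -1)
    (h : (fun x : ℤ => x ^ d + c)^[if d = 2 then 4 else 3] α = ε * y ^ p) :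
    (∃ m : ℕ, ∃ n : ℕ, 1 ≤ n ∧
        (fun x : ℤ => x ^ d + c)^[n] ((fun x : ℤ => x ^ d + c)^[m] α) =
          (fun x : ℤ => x ^ d + c)^[m] α) ∧
    (∃ n : ℕ, 1 ≤ n ∧ (fun x : ℤ => x ^ d + c)^[n] (ε * y ^ p) = ε * y ^ p) := by
  have hperiod : Function.IsPeriodicPt (fun x : ℤ => x ^ d + c) 2
      ((fun x : ℤ => x ^ d + c)^[1] α) := by
    by_cases hd2 : d = 2
    · subst hd2
      obtain rfl : p = 2 := (Nat.prime_dvd_prime_iff_eq hp Nat.prime_two).mp hpd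
      have hbound := pow_gap_translate (e := 1) le_rfl hc hε h
      rw [pow_one, Nat.sub_self, pow_zero, mul_one] at hbound
      exact periodic_of_quadratic rfl rfl rfl hbound
    · obtain ⟨e, rfl⟩ := hpd
      rw [if_neg hd2] at h
      have hbound := sq_abs_le_of_translate hp.two_le (by lia) hc hε h
      refine periodic_of_higher_degree (by lia) hc rfl rfl rfl hbound ?_
      exact fun h2 => (abs_pow_ne hp.two_le y).1
        ((abs_unit_mul_pow hε y p).symm.trans ((congrArg abs h.symm).trans h2))
  refine ⟨⟨1, 2, one_le_two, hperiod⟩, 2, one_le_two, ?_⟩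
  rw [← h]
  split_ifs
  · exact hperiod.apply_iterate 3
  · exact hperiod.apply_iterate 2
end

section
/- Let f(x) = x^d + c with c ∈ ℤ and d ≥ 2. If f is irreducible over ℚ, then every iterate f^n is irreducible over ℚ for all n ≥ 1. -/
open Polynomial

open IntermediateField in
lemma norm_algebraMap_sub_adjoinSimple_gen {K L : Type*} [Field K] [Field L] [Algebra K L]
    {x : L} (hx : IsIntegral K x) (r : K) :
    Algebra.norm K (algebraMap K K⟮x⟯ r - AdjoinSimple.gen K x) = (minpoly K x).eval r := by
  have key := charpoly_leftMulMatrix (adjoin.powerBasis hx)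
  rw [adjoin.powerBasis_gen, minpoly_gen] at key
  rw [← key, Matrix.eval_charpoly, Algebra.norm_eq_matrix_det (adjoin.powerBasis hx).basis,
    map_sub, AlgHom.commutes]
  rfl

open IntermediateField in
lemma norm_adjoinSimple_gen_sub_algebraMap {K L : Type*} [Field K] [Field L] [Algebra K L]
    {x : L} (hx : IsIntegral K x) (r : K) :
    Algebra.norm K (AdjoinSimple.gen K x - algebraMap K K⟮x⟯ r) =
      (-1) ^ (minpoly K x).natDegree * (minpoly K x).eval r := by
  rw [← norm_algebraMap_sub_adjoinSimple_gen hx, ← neg_sub, ← neg_one_mul, map_mul,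
    ← map_one (algebraMap K _), ← map_neg, Algebra.norm_algebraMap, adjoin.finrank hx]

lemma isIntegral_of_minpoly_ne_zero {K L : Type*} [Field K] [Field L] [Algebra K L]
    {x : L} (hx : minpoly K x ≠ 0) : IsIntegral K x :=
  not_not.mp fun h ↦ hx (minpoly.eq_zero h)

/-- A sufficient criterion for irreducibility of binomials, allowing even exponents. -/
lemma X_pow_sub_C_irreducible_of_forall_prime {n : ℕ} (hn : n ≠ 0) :
    ∀ {K : Type*} [Field K] {a : K}, (∀ p : ℕ, p.Prime → p ∣ n → ∀ b : K, b ^ p ≠ a) →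
      (2 ∣ n → ∀ b : K, b ^ 2 ≠ -a) → Irreducible (X ^ n - C a) := by
  induction n using induction_on_primes with
  | zero => exact absurd rfl hn
  | one =>
    intro K _ a _ _
    simpa using irreducible_X_sub_C a
  | prime_mul p n hp IH =>
    intro K _ a ha ha2
    have hn0 : n ≠ 0 := right_ne_zero_of_mul hn
    rw [mul_comm]
    apply X_pow_mul_sub_C_irreducible
      (X_pow_sub_C_irreducible_of_prime hp (ha p hp (dvd_mul_right _ _)))
    intro E _ _ x hx
    have hxi : IsIntegral K x :=
      isIntegral_of_minpoly_ne_zero (hx ▸ X_pow_sub_C_ne_zero hp.pos a)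
    have hN := norm_adjoinSimple_gen_sub_algebraMap hxi 0
    have hNneg := norm_algebraMap_sub_adjoinSimple_gen hxi 0
    simp only [hx, natDegree_X_pow_sub_C, eval_sub, eval_pow, eval_X, eval_C,
      zero_pow hp.ne_zero, zero_sub, map_zero, sub_zero] at hN hNneg
    have hsq : 2 ∣ n → ∀ b, b ^ 2 ≠ -IntermediateField.AdjoinSimple.gen K x := fun h2 b hb ↦
      ha2 (h2.mul_left p) (Algebra.norm K b) (by rw [← map_pow, hb, hNneg])
    refine IH hn0 (fun q hq hqn b hb ↦ ?_) hsq
    have hb' := congrArg (Algebra.norm K) hb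
    rw [map_pow, hN] at hb'
    rcases hp.eq_two_or_odd' with rfl | hpo
    · rcases hq.eq_two_or_odd' with rfl | hqo
      · exact ha2 (dvd_mul_right _ _) _ (by simpa using hb')
      · exact ha q hq (hqn.mul_left _) (-Algebra.norm K b) (by rw [hqo.neg_pow, hb']; simp)
    · exact ha q hq (hqn.mul_left _) _ (by rw [hb', hpo.neg_one_pow]; simp)

lemma Irreducible.comp_X_pow_add_C {K : Type*} [Field K] {g : K[X]} (hg : Irreducible g)
    (hgm : g.Monic) {d : ℕ} (hd : d ≠ 0) {c : K}
    (hodd : ∀ p : ℕ, p.Prime → p ∣ d → ∀ b : K, b ^ p ≠ (-1) ^ g.natDegree * g.eval c)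
    (heven : 2 ∣ d → ∀ b : K, b ^ 2 ≠ g.eval c) :
    Irreducible (g.comp (X ^ d + C c)) := by
  refine irreducible_comp hgm (monic_X_pow_add_C _ hd) hg fun E _ _ x hx ↦ ?_
  have hxi : IsIntegral K x := isIntegral_of_minpoly_ne_zero (hx ▸ hg.ne_zero)
  have hN := norm_adjoinSimple_gen_sub_algebraMap hxi c
  have hNneg := norm_algebraMap_sub_adjoinSimple_gen hxi c
  rw [hx] at hN hNneg
  rw [Polynomial.map_add, Polynomial.map_pow, map_X, map_C, add_sub_assoc, ← C_sub,
    ← neg_sub (IntermediateField.AdjoinSimple.gen K x), C_neg, ← sub_eq_add_neg]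
  refine X_pow_sub_C_irreducible_of_forall_prime hd (fun p hp hpd b hb ↦ ?_) fun h2 b hb ↦ ?_
  · exact hodd p hp hpd (Algebra.norm K b) (by rw [← map_pow, hb, hN])
  · exact heven h2 (Algebra.norm K b) (by rw [← map_pow, hb, neg_sub, hNneg])

lemma exists_int_pow_eq_of_rat_pow_eq {p : ℕ} (hp : p ≠ 0) {y : ℚ} {A : ℤ} (h : y ^ p = A) :
    ∃ z : ℤ, z ^ p = A := by
  have hy : IsIntegral ℤ y := by
    refine IsIntegral.of_pow (Nat.pos_of_ne_zero hp) ?_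
    rw [h]
    exact isIntegral_algebraMap (R := ℤ) (A := ℚ) (x := A)
  obtain ⟨z, rfl⟩ := IsIntegrallyClosed.isIntegral_iff.mp hy
  rw [eq_intCast] at h
  exact ⟨z, by exact_mod_cast h⟩

/-- The orbit of zero under `z ↦ z ^ d + c` is divisible by `c` with coprime cofactor. -/
lemma exists_iterate_zero_eq_mul (c : ℤ) {d : ℕ} (hd : 2 ≤ d) (n : ℕ) :
    ∃ m : ℤ, (fun z : ℤ ↦ z ^ d + c)^[n + 1] 0 = c * m ∧ IsCoprime c m := by
  induction n with
  | zero => exact ⟨1, by simp [show d ≠ 0 by omega], isCoprime_one_right⟩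
  | succ n ih =>
    obtain ⟨m, hm, -⟩ := ih
    obtain ⟨e, rfl⟩ : ∃ e, d = e + 2 := ⟨d - 2, by omega⟩
    refine ⟨c * (c ^ e * m ^ (e + 2)) + 1, ?_, -(c ^ e * m ^ (e + 2)), 1, by ring⟩
    rw [Function.iterate_succ_apply', hm]
    ring

lemma pow_ne_iterate_zero_of_odd {c : ℤ} {d : ℕ} (hd : 2 ≤ d) {p : ℕ} (hp : Odd p)
    (hc : ∀ r : ℤ, r ^ p ≠ c) (n : ℕ) (z : ℤ) : z ^ p ≠ (fun z : ℤ ↦ z ^ d + c)^[n + 1] 0 := by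
  intro hz
  obtain ⟨m, hm, hcop⟩ := exists_iterate_zero_eq_mul c hd n
  obtain ⟨r, hr⟩ := Int.eq_pow_of_mul_eq_pow_odd_left hcop hp (hm.symm.trans hz.symm)
  exact hc r hr.symm

lemma le_iterate_zero {c : ℤ} (hc : 0 < c) (d n : ℕ) :
    c ≤ (fun z : ℤ ↦ z ^ d + c)^[n + 1] 0 := by
  induction n with
  | zero => simp
  | succ n ih =>
    rw [Function.iterate_succ_apply']
    have := pow_nonneg (hc.le.trans ih) d
    simpa using this

lemma sq_ne_iterate_zero {c : ℤ} (hc0 : c ≠ 0) {d : ℕ} (hd : 2 ≤ d) (hd2 : 2 ∣ d)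
    (hc : ∀ r : ℤ, r ^ 2 ≠ -c) (n : ℕ) (z : ℤ) :
    z ^ 2 ≠ (fun z : ℤ ↦ z ^ d + c)^[n + 2] 0 := by
  intro hz
  obtain ⟨m, hm, hcop⟩ := exists_iterate_zero_eq_mul c hd (n + 1)
  obtain ⟨r, hr | hr⟩ := Int.sq_of_isCoprime hcop (hm.symm.trans hz.symm)
  · have hcpos : 0 < c := lt_of_le_of_ne (hr ▸ sq_nonneg r) hc0.symm
    obtain ⟨e, rfl⟩ := hd2
    have hle := le_iterate_zero hcpos (2 * e) n
    rw [Function.iterate_succ_apply'] at hz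
    set a := (fun z : ℤ ↦ z ^ (2 * e) + c)^[n + 1] 0
    have hae : a ≤ a ^ e := le_self_pow₀ (by linarith) (by omega)
    rw [mul_comm 2 e, pow_mul, ← sq_abs z] at hz
    have h1 : a ^ e < |z| := lt_of_pow_lt_pow_left₀ 2 (abs_nonneg z) (by linarith)
    nlinarith
  · exact hc r (by rw [hr, neg_neg])

lemma monic_iterate_comp {R : Type*} [Semiring R] {f : R[X]} [NoZeroDivisors R] (hf : f.Monic)
    (hd : f.natDegree ≠ 0) (n : ℕ) : (f.comp^[n] X).Monic := by
  nontriviality R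
  induction n with
  | zero => exact monic_X
  | succ n ih =>
    rw [Function.iterate_succ_apply']
    exact hf.comp ih (by rw [natDegree_iterate_comp]; simp [hd])

lemma iterate_comp_X_succ {R : Type*} [CommSemiring R] (f : R[X]) (n : ℕ) :
    f.comp^[n + 1] X = (f.comp^[n] X).comp f := by
  induction n with
  | zero => simp
  | succ n ih => rw [Function.iterate_succ_apply', ih, ← comp_assoc, ← Function.iterate_succ_apply' f.comp,
      Nat.succ_eq_add_one, ih]

theorem stmt13 (c : ℤ) (d : ℕ) (hd : 2 ≤ d)
    (hirr : Irreducible ((X : ℚ[X]) ^ d + C (c : ℚ))) :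
    ∀ n : ℕ, 1 ≤ n →
      Irreducible ((fun q : ℚ[X] => ((X : ℚ[X]) ^ d + C (c : ℚ)).comp q)^[n] X) := by
  have hd0 : d ≠ 0 := by omega
  have hirr' : Irreducible ((X : ℚ[X]) ^ d - C (-c : ℚ)) := by rwa [C_neg, sub_neg_eq_add]
  have hpow : ∀ p : ℕ, p ∣ d → p ≠ 1 → ∀ r : ℤ, r ^ p ≠ -c := fun p hpd hp r hr ↦
    pow_ne_of_irreducible_X_pow_sub_C hirr' hpd hp r (by exact_mod_cast hr)
  have hc0 : c ≠ 0 := by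
    rintro rfl
    exact hpow d dvd_rfl (by omega) 0 (by simp [hd0])
  set f : ℚ[X] := X ^ d + C (c : ℚ) with hf
  have hfm : f.Monic := monic_X_pow_add_C _ hd0
  have hfd : f.natDegree = d := natDegree_X_pow_add_C
  have heval : ∀ n, (f.comp^[n] X).eval (c : ℚ) = ((fun z : ℤ ↦ z ^ d + c)^[n + 1] 0 : ℤ) := by
    intro n
    rw [iterate_comp_eval, eval_X, Function.iterate_succ_apply, zero_pow hd0, zero_add]
    refine (Function.Semiconj.iterate_right (f := ((↑) : ℤ → ℚ)) (fun z ↦ ?_) n c).symm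
    simp [hf]
  intro n hn
  change Irreducible (f.comp^[n] X)
  induction n, hn using Nat.le_induction with
  | base => simpa using hirr
  | succ n hn ih =>
    rw [iterate_comp_X_succ]
    obtain ⟨m, rfl⟩ : ∃ m, n = m + 1 := ⟨n - 1, by omega⟩
    have hsq : 2 ∣ d → ∀ y : ℚ, y ^ 2 ≠ ((fun z : ℤ ↦ z ^ d + c)^[m + 2] 0 : ℤ) := by
      intro h2 y hy
      obtain ⟨z, hz⟩ := exists_int_pow_eq_of_rat_pow_eq two_ne_zero hy
      exact sq_ne_iterate_zero hc0 hd h2 (hpow 2 h2 (by norm_num)) m z hz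
    refine ih.comp_X_pow_add_C (monic_iterate_comp hfm (hfd ▸ hd0) _) hd0
      (fun p hp hpd b hb ↦ ?_) fun h2 b hb ↦ hsq h2 b (hb.trans (heval _))
    rw [natDegree_iterate_comp, hfd, natDegree_X, mul_one, heval] at hb
    rcases hp.eq_two_or_odd' with rfl | hpo
    · rw [((even_iff_two_dvd.mpr hpd).pow_of_ne_zero m.succ_ne_zero).neg_one_pow, one_mul] at hb
      exact hsq hpd _ hb
    · obtain ⟨y, hy⟩ : ∃ y : ℚ, y ^ p = ((fun z : ℤ ↦ z ^ d + c)^[m + 2] 0 : ℤ) := by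
        rcases neg_one_pow_eq_or ℚ (d ^ (m + 1)) with h | h
        · exact ⟨b, by rw [hb, h, one_mul]⟩
        · exact ⟨-b, by rw [hpo.neg_pow, hb, h, neg_one_mul, neg_neg]⟩
      obtain ⟨z, hz⟩ := exists_int_pow_eq_of_rat_pow_eq hp.ne_zero hy
      refine pow_ne_iterate_zero_of_odd hd hpo (fun r hr ↦ ?_) (m + 1) z hz
      exact hpow p hpd hp.ne_one (-r) (by rw [hpo.neg_pow, hr])
end
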